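/- Let Ω ⊂ ℝ^d be compact and convex with non-empty interior, V a real finite-dimensional inner product space, and λ > 0. For all μ, ν ∈ M(Ω;V): (i) the vector Kantorovich–Rubinstein problem sup{ ∫_Ω ⟨φ, ν−μ⟩_V : φ ∈ C(Ω;V), |∇φ|_{V^d,∞} ≤ 1, |φ|_{V,∞} ≤ λ } admits a maximizer φ ∈ Fr-Lip(Ω,V); and (ii) its value equals T^λ_{1,1}(μ,ν) = inf{ W₁^V(μ+δ, ν) + λ ∫_Ω |δ|_V : δ ∈ M(Ω;V) }. -/

import Mathlib

open MeasureTheory Set Filter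
open scoped ENNReal RealInnerProductSpace Topology

noncomputable section

/-- Euclidean space `ℝ^d`. -/
abbrev Euc (d : ℕ) := EuclideanSpace ℝ (Fin d)

variable {d : ℕ} {V : Type*} [NormedAddCommGroup V] [InnerProductSpace ℝ V]
  [FiniteDimensional ℝ V]

/-- Frobenius inner product on `V^d ≅ L(ℝ^d; V)`: `⟨A,B⟩ = Tr(Aᵀ B)`. -/
def frobInner (A B : Euc d →L[ℝ] V) : ℝ :=
  ∑ i, ⟪A (EuclideanSpace.single i 1), B (EuclideanSpace.single i 1)⟫

/-- Frobenius norm on `V^d ≅ L(ℝ^d; V)`. -/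
def frobNorm (A : Euc d →L[ℝ] V) : ℝ :=
  Real.sqrt (∑ i, ‖A (EuclideanSpace.single i 1)‖ ^ 2)

/-- Componentwise divergence of a (smooth) map `ψ : ℝ^d → V^d`. -/
def divg (ψ : Euc d → Euc d →L[ℝ] V) (x : Euc d) : V :=
  ∑ i, fderiv ℝ ψ x (EuclideanSpace.single i 1) (EuclideanSpace.single i 1)

/-- Test functions: smooth, compactly supported in the interior of `Ω`. -/
def IsTest (Ω : Set (Euc d)) (ψ : Euc d → Euc d →L[ℝ] V) : Prop :=
  ContDiff ℝ (⊤ : ℕ∞) ψ ∧ HasCompactSupport ψ ∧ tsupport ψ ⊆ interior Ω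

/-- `g` is the (componentwise) distributional gradient of `φ` on `Ω`:
for every test function `ψ`, `∫_Ω ⟨φ, div ψ⟩ = -∫_Ω ⟨g, ψ⟩_{V^d}`. -/
def IsDistribGrad (Ω : Set (Euc d)) (φ : Euc d → V)
    (g : Euc d → Euc d →L[ℝ] V) : Prop :=
  ∀ ψ : Euc d → Euc d →L[ℝ] V, IsTest Ω ψ →
    ∫ x in Ω, ⟪φ x, divg ψ x⟫ = - ∫ x in Ω, frobInner (g x) (ψ x)

/-- `φ ∈ C(Ω;V)` and its distributional gradient admits an `L^∞` representative
whose Frobenius norm is at most `c` almost everywhere on `Ω`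
(i.e. `|∇φ|_{V^d,∞} ≤ c`). -/
def FrLipOn (c : ℝ) (Ω : Set (Euc d)) (φ : Euc d → V) : Prop :=
  ContinuousOn φ Ω ∧ ∃ g : Euc d → Euc d →L[ℝ] V,
    AEStronglyMeasurable g (volume.restrict Ω) ∧
    (∀ᵐ x ∂(volume.restrict Ω), frobNorm (g x) ≤ c) ∧
    IsDistribGrad Ω φ g

/-- A finite `W`-valued measure on `Ω`, represented (by polar decomposition /
Radon–Nikodym) as a density `den` integrable against a positive measure `ρ`
concentrated on `Ω`. -/
structure VMeas (Ω : Set (Euc d)) (W : Type*) [NormedAddCommGroup W] where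
  ρ : Measure (Euc d)
  den : Euc d → W
  null_compl : ρ Ωᶜ = 0
  integrable : Integrable den ρ

namespace VMeas

variable {Ω : Set (Euc d)}

/-- Duality pairing `∫_Ω ⟨φ, μ⟩_V` of `μ ∈ M(Ω;V)` with `φ : Ω → V`. -/
def pair (μ : VMeas Ω V) (φ : Euc d → V) : ℝ :=
  ∫ x, ⟪φ x, μ.den x⟫ ∂μ.ρ

/-- Total variation norm `∫_Ω |μ|_V` of `μ ∈ M(Ω;V)`. -/
def tv (μ : VMeas Ω V) : ℝ := ∫ x, ‖μ.den x‖ ∂μ.ρ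

/-- Total mass `∫_Ω μ ∈ V` of `μ ∈ M(Ω;V)`. -/
def mass (μ : VMeas Ω V) : V := ∫ x, μ.den x ∂μ.ρ

/-- Frobenius duality pairing `∫_Ω ⟨ψ, σ⟩_{V^d}` of `σ ∈ M(Ω;V^d)` with
`ψ : Ω → V^d`. -/
def fpair (σ : VMeas Ω (Euc d →L[ℝ] V)) (ψ : Euc d → Euc d →L[ℝ] V) : ℝ :=
  ∫ x, frobInner (ψ x) (σ.den x) ∂σ.ρ

/-- Total variation norm `∫_Ω |σ|_{V^d}` of `σ ∈ M(Ω;V^d)` w.r.t. the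
Frobenius norm on `V^d`. -/
def ftv (σ : VMeas Ω (Euc d →L[ℝ] V)) : ℝ := ∫ x, frobNorm (σ.den x) ∂σ.ρ

end VMeas

/-- The divergence constraint `div σ = D` (with zero-flux boundary conditions),
in the weak sense: `-∫_Ω ⟨∇φ, σ⟩_{V^d} = D(φ)` for every `φ ∈ C¹(Ω;V)`.
Here `D` is the pairing functional of the prescribed right-hand side. -/
def DivEq {Ω : Set (Euc d)} (σ : VMeas Ω (Euc d →L[ℝ] V))
    (D : (Euc d → V) → ℝ) : Prop :=
  ∀ φ : Euc d → V, ContDiff ℝ 1 φ → -(σ.fpair fun x => fderiv ℝ φ x) = D φ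

/-- The (possibly infinite) value `sup { D(φ) : |∇φ|_{V^d,∞} ≤ 1 }`, used to
define `W₁^V` through the pairing functional `D` of `ν - μ`. -/
def W1fn (Ω : Set (Euc d)) (D : (Euc d → V) → ℝ) : ℝ≥0∞ :=
  ⨆ φ ∈ {φ : Euc d → V | FrLipOn 1 Ω φ}, ENNReal.ofReal (D φ)

set_option linter.unusedSectionVars false
def toPi : (Euc d →L[ℝ] V) →L[ℝ] PiLp 2 (fun _ : Fin d => V) :=
  (PiLp.continuousLinearEquiv 2 ℝ (fun _ : Fin d => V)).symm.toContinuousLinearMap.comp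
    (ContinuousLinearMap.pi fun i =>
      ContinuousLinearMap.apply ℝ V (EuclideanSpace.single i (1 : ℝ)))

lemma toPi_apply (A : Euc d →L[ℝ] V) (i : Fin d) :
    toPi A i = A (EuclideanSpace.single i 1) := rfl

lemma frobInner_eq (A B : Euc d →L[ℝ] V) : frobInner A B = ⟪toPi A, toPi B⟫ := by
  simp [frobInner, PiLp.inner_apply, toPi_apply]

lemma frobNorm_eq (A : Euc d →L[ℝ] V) : frobNorm A = ‖toPi A‖ := by
  simp [frobNorm, PiLp.norm_eq_of_L2, toPi_apply]

lemma frobNorm_rank (v : Euc d) (w : V) (c : ℝ) :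
    frobNorm (c • (innerSL ℝ v).smulRight w) = |c| * (‖v‖ * ‖w‖) := by
  rw [frobNorm]
  have : ∀ i, ‖(c • (innerSL ℝ v).smulRight w) (EuclideanSpace.single i (1:ℝ))‖ ^ 2
      = (|c| * ‖w‖) ^ 2 * (v i) ^ 2 := by
    intro i
    simp [norm_smul, mul_pow, EuclideanSpace.inner_single_right]
    ring
  simp_rw [this]
  rw [← Finset.mul_sum, Real.sqrt_mul (by positivity), Real.sqrt_sq (by positivity),
    EuclideanSpace.norm_eq]
  simp
  ring

lemma euc_sum (v : Euc d) : ∑ i, v i • (EuclideanSpace.single i (1:ℝ) : Euc d) = v := by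
  ext j
  simp [Pi.single_apply]

lemma scal (Ω : Set (Euc d)) (hΩ : IsCompact Ω) (φ : Euc d → V)
    (hφ : FrLipOn 1 Ω φ) (v : Euc d) (w : V) (x : Euc d) (η : Euc d → ℝ)
    (hη : ContDiff ℝ (⊤ : ℕ∞) η) (hη0 : ∀ y, 0 ≤ η y) (hη1 : ∫ y, η y = 1)
    (hηc : HasCompactSupport η)
    (hs : tsupport (fun y => η (x - y)) ⊆ interior Ω) :
    |∫ y in Ω, ⟪φ y, w⟫ * fderiv ℝ η (x - y) v| ≤ ‖v‖ * ‖w‖ := by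
  obtain ⟨hc, g, hgm, hg1, hg⟩ := hφ
  set T : Euc d →L[ℝ] V := (innerSL ℝ v).smulRight w with hT
  have hsm : ContDiff ℝ (⊤ : ℕ∞) (fun y => η (x - y)) := hη.comp (contDiff_const.sub contDiff_id)
  have hcs : HasCompactSupport (fun y => η (x - y)) :=
    HasCompactSupport.of_support_subset_isCompact (hΩ)
      ((subset_tsupport _).trans (hs.trans interior_subset))
  have htest : IsTest Ω (fun y => η (x - y) • T) := by
    refine ⟨hsm.smul contDiff_const, ?_, ?_⟩
    · exact hcs.smul_right
    · refine (closure_mono fun y hy => ?_).trans hs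
      intro h0; exact hy (by simp [h0])
  have hdiv : ∀ y, divg (fun y => η (x - y) • T) y = - (fderiv ℝ η (x - y) v • w) := by
    intro y
    have h1 : HasFDerivAt (fun y => η (x - y) • T)
        (((fderiv ℝ η (x - y)).comp (-ContinuousLinearMap.id ℝ (Euc d))).smulRight T) y := by
      have h2 : HasFDerivAt η (fderiv ℝ η (x - y)) (x - y) :=
        ((hη.differentiable (by simp)) _).hasFDerivAt
      have h3 : HasFDerivAt (fun y => x - y) (-ContinuousLinearMap.id ℝ (Euc d)) y :=
        (hasFDerivAt_id y).const_sub x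
      exact (h2.comp y h3).smul_const T
    rw [divg, h1.fderiv]
    conv_rhs => rw [← euc_sum v]
    simp only [map_sum, Finset.sum_smul, ← Finset.sum_neg_distrib]
    refine Finset.sum_congr rfl fun i _ => ?_
    simp [hT, EuclideanSpace.inner_single_right, smul_smul, mul_comm]
  have key := hg _ htest
  have e1 : ∫ y in Ω, ⟪φ y, divg (fun y => η (x - y) • T) y⟫
      = - ∫ y in Ω, ⟪φ y, w⟫ * fderiv ℝ η (x - y) v := by
    rw [← integral_neg]
    congr 1
    ext y
    rw [hdiv, inner_neg_right, inner_smul_right, mul_comm]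
  rw [e1, neg_inj] at key
  rw [key]
  have hint : Integrable (fun y => η (x - y)) := hsm.continuous.integrable_of_hasCompactSupport hcs
  calc |∫ y in Ω, frobInner (g y) (η (x - y) • T)|
      = ‖∫ y in Ω, frobInner (g y) (η (x - y) • T)‖ := rfl
    _ ≤ ∫ y in Ω, η (x - y) * (‖v‖ * ‖w‖) := by
        apply norm_integral_le_of_norm_le
        · exact (hint.mul_const _).integrableOn
        · filter_upwards [hg1] with y hy
          rw [frobInner_eq]
          refine (norm_inner_le_norm _ _).trans ?_
          rw [← frobNorm_eq, ← frobNorm_eq, frobNorm_rank, abs_of_nonneg (hη0 _)]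
          exact mul_le_of_le_one_left (mul_nonneg (hη0 _) (by positivity)) hy
    _ ≤ ∫ y, η (x - y) * (‖v‖ * ‖w‖) :=
        setIntegral_le_integral (hint.mul_const _)
          (Eventually.of_forall fun y => mul_nonneg (hη0 _) (by positivity))
    _ = ‖v‖ * ‖w‖ := by
        rw [integral_mul_const, integral_sub_left_eq_self (fun y => η y) volume x, hη1, one_mul]

lemma scal_lip (Ω : Set (Euc d)) (hΩ : IsCompact Ω) (hconv : Convex ℝ Ω) (φ : Euc d → V)
    (hφ : FrLipOn 1 Ω φ) (w : V) (x y : Euc d) (hx : x ∈ interior Ω) (hy : y ∈ interior Ω) :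
    |⟪φ x, w⟫ - ⟪φ y, w⟫| ≤ ‖w‖ * ‖x - y‖ := by
  have hc := hφ.1
  set f : Euc d → ℝ := Ω.indicator (fun z => ⟪φ z, w⟫) with hf
  have hcw : ContinuousOn (fun z => ⟪φ z, w⟫) Ω := hc.inner continuousOn_const
  have hfi : Integrable f := (hcw.integrableOn_compact hΩ).integrable_indicator hΩ.measurableSet
  have hfc : ∀ z ∈ interior Ω, ContinuousAt f z := by
    intro z hz
    have h1 : ContinuousAt (fun z => ⟪φ z, w⟫) z := hcw.continuousAt (mem_interior_iff_mem_nhds.1 hz)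
    refine h1.congr ?_
    filter_upwards [mem_interior_iff_mem_nhds.1 hz] with u hu
    simp [hf, hu]
  have hfv : ∀ z ∈ interior Ω, f z = ⟪φ z, w⟫ := fun z hz => by
    simp [hf, interior_subset hz]
  rw [← hfv x hx, ← hfv y hy]
  have hseg : segment ℝ x y ⊆ interior Ω := hconv.interior.segment_subset hx hy
  have hsc : IsCompact (segment ℝ x y) := by
    rw [segment_eq_image]
    exact isCompact_Icc.image (by fun_prop)
  obtain ⟨r, hr, hrs⟩ := hsc.exists_cthickening_subset_open isOpen_interior hseg
  have step : ∀ ε > 0, |f x - f y| ≤ ‖w‖ * ‖x - y‖ + 2 * ε := by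
    intro ε hε
    obtain ⟨r1, hr1, h1⟩ := Metric.continuousAt_iff.1 (hfc x hx) ε hε
    obtain ⟨r2, hr2, h2⟩ := Metric.continuousAt_iff.1 (hfc y hy) ε hε
    set R := min r (min r1 r2) with hR
    have hRpos : 0 < R := lt_min hr (lt_min hr1 hr2)
    let b : ContDiffBump (0 : Euc d) := ⟨R / 2, R, by linarith, by linarith⟩
    set η := b.normed (volume : Measure (Euc d)) with hη
    set F : Euc d → ℝ := convolution η f (ContinuousLinearMap.lsmul ℝ ℝ) volume with hF
    have d1 : dist (F x) (f x) ≤ ε := b.dist_normed_convolution_le hfi.aestronglyMeasurable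
      (fun z hz => (h1 (lt_of_lt_of_le hz ((min_le_right _ _).trans (min_le_left _ _)))).le)
    have d2 : dist (F y) (f y) ≤ ε := b.dist_normed_convolution_le hfi.aestronglyMeasurable
      (fun z hz => (h2 (lt_of_lt_of_le hz ((min_le_right _ _).trans (min_le_right _ _)))).le)
    have hder : ∀ z, HasFDerivAt F ((convolution (fderiv ℝ η) f
        ((ContinuousLinearMap.lsmul ℝ ℝ).precompL (Euc d)) volume) z) z := fun z =>
      b.hasCompactSupport_normed.hasFDerivAt_convolution_left _ b.contDiff_normed
        hfi.locallyIntegrable z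
    have hbound : ∀ z ∈ segment ℝ x y, ‖(convolution (fderiv ℝ η) f
        ((ContinuousLinearMap.lsmul ℝ ℝ).precompL (Euc d)) volume) z‖ ≤ ‖w‖ := by
      intro z hz
      refine ContinuousLinearMap.opNorm_le_bound _ (norm_nonneg _) fun v => ?_
      have hex : ConvolutionExistsAt (fderiv ℝ η) f z
          ((ContinuousLinearMap.lsmul ℝ ℝ).precompL (Euc d)) volume :=
        (HasCompactSupport.convolutionExists_left _ (b.hasCompactSupport_normed.fderiv ℝ)
          ((b.contDiff_normed (n := 1)).continuous_fderiv (by simp)) hfi.locallyIntegrable) z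
      have hval : (convolution (fderiv ℝ η) f
        ((ContinuousLinearMap.lsmul ℝ ℝ).precompL (Euc d)) volume) z v
          = ∫ y in Ω, ⟪φ y, w⟫ * fderiv ℝ η (z - y) v := by
        rw [convolution_eq_swap, ContinuousLinearMap.integral_apply]
        · rw [← integral_indicator hΩ.measurableSet]
          congr 1
          ext u
          by_cases hu : u ∈ Ω <;> simp [hf, hu, ContinuousLinearMap.precompL_apply, mul_comm]
        · exact (hex.integrable_swap)
      rw [hval, Real.norm_eq_abs, mul_comm]
      refine scal Ω hΩ φ hφ v w z η b.contDiff_normed b.nonneg_normed b.integral_normed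
        b.hasCompactSupport_normed ?_
      refine Subset.trans ?_ hrs
      have : Function.support (fun y => η (z - y)) ⊆ Metric.closedBall z r := by
        intro u hu
        have : z - u ∈ Function.support η := hu
        rw [hη, b.support_normed_eq] at this
        rw [mem_ball_zero_iff] at this
        rw [mem_closedBall_iff_norm, norm_sub_rev]
        exact this.le.trans (min_le_left _ _)
      refine (closure_minimal this Metric.isClosed_closedBall).trans ?_
      exact Metric.closedBall_subset_cthickening hz r
    have hmv := (convex_segment x y).norm_image_sub_le_of_norm_hasFDerivWithin_le
      (fun z hz => (hder z).hasFDerivWithinAt) hbound (right_mem_segment ℝ x y)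
      (left_mem_segment ℝ x y)
    rw [Real.norm_eq_abs] at hmv
    rw [Real.dist_eq] at d1 d2
    rw [abs_le] at *
    constructor <;> linarith [d1.1, d1.2, d2.1, d2.2, hmv.1, hmv.2]
  refine le_of_forall_pos_le_add fun ε hε => ?_
  have := step (ε / 2) (by positivity)
  linarith

lemma frlip_lip (Ω : Set (Euc d)) (hΩ : IsCompact Ω) (hconv : Convex ℝ Ω)
    (hint : (interior Ω).Nonempty) (φ : Euc d → V)
    (hφ : FrLipOn 1 Ω φ) : LipschitzOnWith 1 φ Ω := by
  have h1 : LipschitzOnWith 1 φ (interior Ω) := by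
    refine LipschitzOnWith.of_dist_le_mul fun x hx y hy => ?_
    rw [dist_eq_norm, dist_eq_norm]
    have := scal_lip Ω hΩ hconv φ hφ (φ x - φ y) x y hx hy
    rw [← inner_sub_left, real_inner_self_eq_norm_sq, abs_of_nonneg (by positivity)] at this
    rcases (norm_nonneg (φ x - φ y)).eq_or_lt with h0 | h0
    · rw [← h0]; positivity
    · simp only [NNReal.coe_one, one_mul]
      nlinarith
  have hcl : closure (interior Ω) = Ω := by
    rw [hconv.closure_interior_eq_closure_of_nonempty_interior hint, hΩ.isClosed.closure_eq]
  have := h1.closure (by rw [hcl]; exact hφ.1)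
  rwa [hcl] at this

lemma distrib_congr {Ω : Set (Euc d)} (hΩ : IsCompact Ω) {φ φ' : Euc d → V}
    {g : Euc d → Euc d →L[ℝ] V} (h : EqOn φ φ' Ω) (hg : IsDistribGrad Ω φ g) :
    IsDistribGrad Ω φ' g := by
  intro ψ hψ
  rw [← hg ψ hψ]
  refine setIntegral_congr_fun hΩ.measurableSet fun x hx => ?_
  simp only [h hx]

lemma frlip_congr {Ω : Set (Euc d)} (hΩ : IsCompact Ω) {φ φ' : Euc d → V} {c : ℝ}
    (h : EqOn φ φ' Ω) (hφ : FrLipOn c Ω φ) : FrLipOn c Ω φ' := by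
  obtain ⟨hc, g, hgm, hg1, hg⟩ := hφ
  exact ⟨hc.congr h.symm, g, hgm, hg1, distrib_congr hΩ h hg⟩

lemma divg_cont {Ω : Set (Euc d)} {ψ : Euc d → Euc d →L[ℝ] V} (hψ : IsTest Ω ψ) :
    Continuous (divg ψ) := by
  have h := hψ.1.continuous_fderiv (by simp)
  unfold divg
  fun_prop

lemma inner_int {Ω : Set (Euc d)} (hΩ : IsCompact Ω) {φ : Euc d → V} (hφ : ContinuousOn φ Ω)
    {ψ : Euc d → Euc d →L[ℝ] V} (hψ : IsTest Ω ψ) :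
    IntegrableOn (fun x => ⟪φ x, divg ψ x⟫) Ω :=
  (hφ.inner (divg_cont hψ).continuousOn).integrableOn_compact hΩ

lemma test_memLp {Ω : Set (Euc d)} {ψ : Euc d → Euc d →L[ℝ] V} (hψ : IsTest Ω ψ) (p : ℝ≥0∞) :
    MemLp (fun x => toPi (ψ x)) p (volume.restrict Ω) := by
  have h1 : Continuous (fun x => toPi (ψ x)) := toPi.continuous.comp hψ.1.continuous
  have h2 : HasCompactSupport (fun x => toPi (ψ x)) := hψ.2.1.comp_left (map_zero _)
  exact (h1.memLp_of_hasCompactSupport h2).restrict _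

lemma g_memLp {Ω : Set (Euc d)} (hΩ : IsCompact Ω) {g : Euc d → Euc d →L[ℝ] V} {c : ℝ}
    (hgm : AEStronglyMeasurable g (volume.restrict Ω))
    (hg1 : ∀ᵐ x ∂(volume.restrict Ω), frobNorm (g x) ≤ c) (p : ℝ≥0∞) :
    MemLp (fun x => toPi (g x)) p (volume.restrict Ω) := by
  have : IsFiniteMeasure (volume.restrict Ω) := ⟨by simpa using hΩ.measure_lt_top⟩
  refine MemLp.of_bound (toPi.continuous.comp_aestronglyMeasurable hgm) c ?_
  filter_upwards [hg1] with x hx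
  rwa [← frobNorm_eq]

lemma frob_int {Ω : Set (Euc d)} (hΩ : IsCompact Ω) {g : Euc d → Euc d →L[ℝ] V} {c : ℝ}
    (hgm : AEStronglyMeasurable g (volume.restrict Ω))
    (hg1 : ∀ᵐ x ∂(volume.restrict Ω), frobNorm (g x) ≤ c)
    {ψ : Euc d → Euc d →L[ℝ] V} (hψ : IsTest Ω ψ) :
    IntegrableOn (fun x => frobInner (g x) (ψ x)) Ω := by
  simp_rw [frobInner_eq]
  refine (L2.integrable_inner (𝕜 := ℝ) ((g_memLp hΩ hgm hg1 2).toLp _)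
    ((test_memLp hψ 2).toLp _)).congr ?_
  filter_upwards [(g_memLp hΩ hgm hg1 2).coeFn_toLp, (test_memLp hψ 2).coeFn_toLp] with x h1 h2
  rw [h1, h2]

lemma frlip_comb {Ω : Set (Euc d)} (hΩ : IsCompact Ω) {φ φ' : Euc d → V} {c c' : ℝ} (a b : ℝ)
    (hφ : FrLipOn c Ω φ) (hφ' : FrLipOn c' Ω φ') :
    FrLipOn (|a| * c + |b| * c') Ω (fun x => a • φ x + b • φ' x) := by
  obtain ⟨hc, g, hgm, hg1, hg⟩ := hφ
  obtain ⟨hc', g', hgm', hg1', hg'⟩ := hφ'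
  refine ⟨(hc.const_smul a).add (hc'.const_smul b), fun x => a • g x + b • g' x,
    (hgm.const_smul a).add (hgm'.const_smul b), ?_, ?_⟩
  · filter_upwards [hg1, hg1'] with x h1 h2
    rw [frobNorm_eq] at *
    rw [map_add, map_smul, map_smul]
    refine (norm_add_le _ _).trans ?_
    rw [norm_smul, norm_smul, Real.norm_eq_abs, Real.norm_eq_abs]
    gcongr
  · intro ψ hψ
    have e1 : ∀ x, ⟪a • φ x + b • φ' x, divg ψ x⟫ = a * ⟪φ x, divg ψ x⟫ + b * ⟪φ' x, divg ψ x⟫ := by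
      intro x
      rw [inner_add_left, real_inner_smul_left, real_inner_smul_left]
    have e2 : ∀ x, frobInner (a • g x + b • g' x) (ψ x)
        = a * frobInner (g x) (ψ x) + b * frobInner (g' x) (ψ x) := by
      intro x
      simp only [frobInner_eq]
      rw [map_add, map_smul, map_smul, inner_add_left, real_inner_smul_left, real_inner_smul_left]
    simp_rw [e1, e2]
    rw [integral_add ((inner_int hΩ hc hψ).const_mul a) ((inner_int hΩ hc' hψ).const_mul b),
      integral_add ((frob_int hΩ hgm hg1 hψ).const_mul a) ((frob_int hΩ hgm' hg1' hψ).const_mul b)]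
    simp only [integral_const_mul]
    rw [hg ψ hψ, hg' ψ hψ]
    ring

lemma frlip_const {Ω : Set (Euc d)} (hΩ : IsCompact Ω) (v : V) :
    FrLipOn 0 Ω (fun _ => v) := by
  refine ⟨continuousOn_const, fun _ => 0, aestronglyMeasurable_const, ?_, ?_⟩
  · exact Eventually.of_forall fun x => by simp [frobNorm]
  · intro ψ hψ
    have hz : ∀ x, frobInner (0 : Euc d →L[ℝ] V) (ψ x) = 0 := by intro x; simp [frobInner]
    simp_rw [hz]
    simp only [integral_zero, neg_zero]
    have hfz : ∀ x ∉ Ω, ⟪v, divg ψ x⟫ = 0 := by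
      intro x hx
      have : fderiv ℝ ψ x = 0 := by
        by_contra h
        exact hx (interior_subset (hψ.2.2 (support_fderiv_subset ℝ h)))
      simp [divg, this]
    rw [setIntegral_eq_integral_of_forall_compl_eq_zero hfz]
    simp_rw [divg, inner_sum]
    have hcont := hψ.1.continuous_fderiv (by simp)
    have hcs : HasCompactSupport (fderiv ℝ ψ) := hψ.2.1.fderiv ℝ
    have hI : ∀ i : Fin d, Integrable (fun x => ⟪v, fderiv ℝ ψ x (EuclideanSpace.single i 1)
        (EuclideanSpace.single i 1)⟫) := by
      intro i
      refine Continuous.integrable_of_hasCompactSupport (by fun_prop) ?_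
      exact hcs.comp_left (g := fun T => ⟪v, T (EuclideanSpace.single i 1)
        (EuclideanSpace.single i 1)⟫) (by simp)
    rw [integral_finsetSum _ fun i _ => hI i]
    refine Finset.sum_eq_zero fun i _ => ?_
    have hIi := hI i
    generalize (EuclideanSpace.single i (1:ℝ) : Euc d) = e at hIi ⊢
    let f : Euc d → ℝ := fun x => ⟪v, ψ x e⟫
    let Lc : (Euc d →L[ℝ] V) →L[ℝ] ℝ := (innerSL ℝ v).comp (ContinuousLinearMap.apply ℝ V e)
    have hf : ∀ x, HasFDerivAt f (Lc.comp (fderiv ℝ ψ x)) x := by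
      intro x
      have h1 : HasFDerivAt ψ (fderiv ℝ ψ x) x := ((hψ.1.differentiable (by simp)) x).hasFDerivAt
      exact Lc.hasFDerivAt.comp x h1
    have hfd : ∀ x, fderiv ℝ f x e = ⟪v, fderiv ℝ ψ x e e⟫ := by
      intro x; rw [(hf x).fderiv]; rfl
    have hfI : Integrable f := by
      have h2 : Continuous f := Lc.continuous.comp hψ.1.continuous
      have h3 : HasCompactSupport f := hψ.2.1.comp_left (g := Lc) (map_zero Lc)
      exact h2.integrable_of_hasCompactSupport h3
    have hfdI : Integrable (fun x => fderiv ℝ f x e) := by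
      simp_rw [hfd]; exact hIi
    have := integral_mul_fderiv_eq_neg_fderiv_mul_of_integrable (μ := (volume : Measure (Euc d)))
      (f := fun _ => (1:ℝ)) (g := f) (v := e) (by simp) (by simpa using hfdI) (by simpa using hfI)
      (fun x _ => differentiableAt_const _) (fun x _ => (hf x).differentiableAt)
    simp_rw [hfd] at this
    simpa using this

def fromPi (v : PiLp 2 (fun _ : Fin d => V)) : Euc d →L[ℝ] V :=
  ∑ i, (EuclideanSpace.proj i : Euc d →L[ℝ] ℝ).smulRight (v i)

lemma toPi_fromPi (v : PiLp 2 (fun _ : Fin d => V)) : toPi (fromPi v) = v := by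
  ext j
  rw [toPi_apply, fromPi]
  simp [Pi.single_apply]

lemma fromPi_cont : Continuous (fromPi : PiLp 2 (fun _ : Fin d => V) → Euc d →L[ℝ] V) := by
  unfold fromPi
  refine continuous_finsetSum _ fun i _ => ?_
  exact (ContinuousLinearMap.smulRightL ℝ (Euc d) V (EuclideanSpace.proj i)).continuous.comp
    (by fun_prop : Continuous fun v : PiLp 2 (fun _ : Fin d => V) => v i)

lemma frlip_closed {Ω : Set (Euc d)} (hΩ : IsCompact Ω) {φ : Euc d → V} {φn : ℕ → Euc d → V}
    (hn : ∀ n, FrLipOn 1 Ω (φn n)) (hc : ContinuousOn φ Ω)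
    (hlim : ∀ ε > 0, ∀ᶠ n in atTop, ∀ x ∈ Ω, ‖φn n x - φ x‖ ≤ ε) : FrLipOn 1 Ω φ := by
  have : IsFiniteMeasure (volume.restrict Ω) := ⟨by simpa using hΩ.measure_lt_top⟩
  choose hcn gn hgm hg1 hg using hn
  set m : Measure (Euc d) := volume.restrict Ω with hm
  let G : ℕ → Lp (PiLp 2 (fun _ : Fin d => V)) 2 m :=
    fun n => (g_memLp hΩ (hgm n) (hg1 n) 2).toLp _
  have hG : ∀ n, G n =ᵐ[m] fun x => toPi (gn n x) := fun n => MemLp.coeFn_toLp _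
  have hGb : ∀ n, ∀ᵐ x ∂m, ‖G n x‖ ≤ 1 := by
    intro n
    filter_upwards [hG n, hg1 n] with x h1 h2
    rwa [h1, ← frobNorm_eq]
  -- uniform bound
  obtain ⟨C, hC⟩ : ∃ C : ℝ, ∀ n, ‖G n‖ ≤ C := by
    refine ⟨_, fun n => Lp.norm_le_of_ae_bound zero_le_one (hGb n)⟩
  let D := InnerProductSpace.toDual ℝ (Lp (PiLp 2 (fun _ : Fin d => V)) 2 m)
  let ℓ : ℕ → WeakDual ℝ (Lp (PiLp 2 (fun _ : Fin d => V)) 2 m) :=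
    fun n => StrongDual.toWeakDual (D (G n))
  have hcomp := WeakDual.isCompact_closedBall (𝕜 := ℝ)
    (E := Lp (PiLp 2 (fun _ : Fin d => V)) 2 m) 0 C
  let U : Ultrafilter ℕ := hyperfilter ℕ
  have hU : (U : Filter ℕ) ≤ atTop := Nat.hyperfilter_le_atTop
  obtain ⟨L, -, hL⟩ := hcomp.ultrafilter_le_nhds (U.map ℓ) (by
    rw [le_principal_iff]
    refine Filter.mem_map.2 (Eventually.of_forall fun n => ?_)
    refine mem_closedBall_zero_iff.2 ?_
    change ‖D (G n)‖ ≤ C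
    rw [LinearIsometryEquiv.norm_map]
    exact hC n)
  have hL' : Tendsto ℓ U (𝓝 L) := hL
  let G₀ : Lp (PiLp 2 (fun _ : Fin d => V)) 2 m := D.symm (WeakDual.toStrongDual L)
  have hconv : ∀ h, Tendsto (fun n => ⟪G n, h⟫) U (𝓝 ⟪G₀, h⟫) := by
    intro h
    have h1 := ((WeakDual.eval_continuous h).tendsto L).comp hL'
    have h2 : ⟪G₀, h⟫ = L h := by
      rw [← InnerProductSpace.toDual_apply_apply]
      change D (D.symm _) h = _
      rw [LinearIsometryEquiv.apply_symm_apply]; rfl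
    rw [h2]
    exact h1
  refine ⟨hc, fun x => fromPi (G₀ x),
    fromPi_cont.comp_aestronglyMeasurable (Lp.aestronglyMeasurable G₀), ?_, ?_⟩
  · -- bound
    simp_rw [frobNorm_eq, toPi_fromPi]
    have hsm := Lp.stronglyMeasurable G₀
    set E : Set (Euc d) := {x | 1 < ‖G₀ x‖} with hE
    have hEm : MeasurableSet E := measurableSet_lt measurable_const hsm.norm.measurable
    have hmem : MemLp (E.indicator G₀) 2 m := (Lp.memLp G₀).indicator hEm
    let h := hmem.toLp _
    have hh : h =ᵐ[m] E.indicator G₀ := MemLp.coeFn_toLp _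
    have hI1 : Integrable (fun x => ‖E.indicator G₀ x‖) m :=
      (hmem.integrable (by norm_num)).norm
    have hI2 : Integrable (fun x => ‖E.indicator G₀ x‖ ^ 2) m := hmem.integrable_norm_pow (by norm_num)
    have b1 : ∀ n, ⟪G n, h⟫ ≤ ∫ x, ‖E.indicator G₀ x‖ ∂m := by
      intro n
      rw [L2.inner_def]
      refine integral_mono_ae (L2.integrable_inner _ _) hI1 ?_
      filter_upwards [hh, hGb n] with x h1 h2
      rw [h1]
      exact (real_inner_le_norm _ _).trans (mul_le_of_le_one_left (norm_nonneg _) h2)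
    have b2 : ⟪G₀, h⟫ ≤ ∫ x, ‖E.indicator G₀ x‖ ∂m :=
      le_of_tendsto (hconv h) (Eventually.of_forall b1)
    have b3 : ⟪G₀, h⟫ = ∫ x, ‖E.indicator G₀ x‖ ^ 2 ∂m := by
      rw [L2.inner_def]
      refine integral_congr_ae ?_
      filter_upwards [hh] with x h1
      simp only [h1]
      by_cases hx : x ∈ E <;> simp [hx]
    have hnn : ∀ x, 0 ≤ ‖E.indicator G₀ x‖ ^ 2 - ‖E.indicator G₀ x‖ := by
      intro x
      by_cases hx : x ∈ E
      · have : 1 < ‖G₀ x‖ := hx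
        simp only [indicator_of_mem hx]
        nlinarith
      · simp [hx]
    have hzero : ∫ x, (‖E.indicator G₀ x‖ ^ 2 - ‖E.indicator G₀ x‖) ∂m = 0 := by
      refine le_antisymm ?_ (integral_nonneg hnn)
      rw [integral_sub hI2 hI1]
      linarith
    rw [integral_eq_zero_iff_of_nonneg hnn (hI2.sub hI1)] at hzero
    filter_upwards [hzero] with x hx
    by_contra hlt
    have hxE : x ∈ E := not_le.1 hlt
    have : 1 < ‖G₀ x‖ := hxE
    simp only [indicator_of_mem hxE, Pi.zero_apply] at hx
    nlinarith
  · intro ψ hψ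
    let h := (test_memLp hψ 2).toLp _
    have hh : h =ᵐ[m] fun x => toPi (ψ x) := MemLp.coeFn_toLp _
    have e0 : ∫ x in Ω, frobInner (fromPi (G₀ x)) (ψ x) = ⟪G₀, h⟫ := by
      rw [L2.inner_def]
      refine integral_congr_ae ?_
      filter_upwards [hh] with x h1
      rw [h1, frobInner_eq, toPi_fromPi]
    have en : ∀ n, ⟪G n, h⟫ = - ∫ x in Ω, ⟪φn n x, divg ψ x⟫ := by
      intro n
      rw [hg n ψ hψ, neg_neg, L2.inner_def]
      refine integral_congr_ae ?_
      filter_upwards [hh, hG n] with x h1 h2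
      rw [h1, h2, frobInner_eq]
    have hdI : Integrable (fun x => ‖divg ψ x‖) m :=
      ((divg_cont hψ).norm.continuousOn.integrableOn_compact hΩ)
    have ht : Tendsto (fun n => ∫ x in Ω, ⟪φn n x, divg ψ x⟫) atTop
        (𝓝 (∫ x in Ω, ⟪φ x, divg ψ x⟫)) := by
      rw [Metric.tendsto_atTop']
      intro ε hε
      set K := ∫ x, ‖divg ψ x‖ ∂m with hK
      have hK0 : 0 ≤ K := integral_nonneg fun x => norm_nonneg _
      have hev := hlim (ε / (K + 1)) (by positivity)
      obtain ⟨N, hN⟩ := eventually_atTop.1 hev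
      refine ⟨N, fun n hnN => ?_⟩
      rw [dist_eq_norm, ← integral_sub (inner_int hΩ (hcn n) hψ) (inner_int hΩ hc hψ)]
      have : ‖∫ x in Ω, (⟪φn n x, divg ψ x⟫ - ⟪φ x, divg ψ x⟫)‖
          ≤ ∫ x in Ω, (ε / (K + 1)) * ‖divg ψ x‖ := by
        refine norm_integral_le_of_norm_le (hdI.const_mul _) ?_
        filter_upwards [ae_restrict_mem hΩ.measurableSet] with x hx
        rw [← inner_sub_left]
        refine (norm_inner_le_norm _ _).trans ?_
        gcongr
        exact hN n hnN.le x hx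
      refine this.trans_lt ?_
      rw [integral_const_mul]
      change ε / (K + 1) * K < ε
      rw [div_mul_eq_mul_div, div_lt_iff₀ (by positivity)]
      nlinarith
    have ht2 : Tendsto (fun n => ⟪G n, h⟫) U (𝓝 (- ∫ x in Ω, ⟪φ x, divg ψ x⟫)) := by
      simp_rw [en]
      exact (ht.mono_left hU).neg
    have := tendsto_nhds_unique ht2 (hconv h)
    rw [e0, ← this, neg_neg]

lemma dual_abs {X : Type*} [NormedAddCommGroup X] [NormedSpace ℝ X] {ι : Type*} [DecidableEq ι]
    (K : Set X) (hK : IsCompact K) (hKc : Convex ℝ K) (h0 : (0 : X) ∈ K) (D : X →L[ℝ] ℝ)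
    (ev : ι → X →L[ℝ] V) (lam M : ℝ) (hlam : 0 < lam) (i0 : ι)
    (hM : ∀ f ∈ K, (∀ i, ‖ev i f‖ ≤ lam) → D f < M) :
    ∃ (F : Finset ι) (δ : ι → V), i0 ∈ F ∧
      ∀ f ∈ K, D f - ∑ i ∈ F, ⟪ev i f, δ i⟫ + lam * ∑ i ∈ F, ‖δ i‖ ≤ M := by
  obtain ⟨F0, hF0⟩ : ∃ F0 : Finset ι, (K ∩ {f | M ≤ D f}) ∩ ⋂ i ∈ F0, {f | ‖ev i f‖ ≤ lam} = ∅ := by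
    apply IsCompact.elim_finite_subfamily_closed
    · exact hK.inter_right (isClosed_le continuous_const D.continuous)
    · intro i
      exact isClosed_le (ev i).continuous.norm continuous_const
    · rw [eq_empty_iff_forall_notMem]
      rintro f ⟨⟨hf1, hf2⟩, hf3⟩
      rw [mem_iInter] at hf3
      exact absurd (hM f hf1 hf3) (not_lt.2 hf2)
  set F := insert i0 F0 with hF
  have hFM : ∀ f ∈ K, (∀ i ∈ F, ‖ev i f‖ ≤ lam) → D f < M := by
    intro f hf h
    by_contra hlt
    have : f ∈ (K ∩ {f | M ≤ D f}) ∩ ⋂ i ∈ F0, {f | ‖ev i f‖ ≤ lam} := by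
      refine ⟨⟨hf, not_lt.1 hlt⟩, ?_⟩
      simp only [mem_iInter]
      intro i hi
      exact h i (Finset.mem_insert_of_mem hi)
    rw [hF0] at this
    exact this
  let T : X →L[ℝ] ℝ × (F → V) := D.prod (ContinuousLinearMap.pi fun i : F => ev i)
  have hMpos : 0 < M := by simpa using hM 0 h0 (by simp [hlam.le])
  set C : Set (ℝ × (F → V)) := {p | M ≤ p.1 ∧ ∀ i, ‖p.2 i‖ ≤ lam} with hC
  have hCclosed : IsClosed C := by
    have e : C = {p | M ≤ p.1} ∩ ⋂ i, {p | ‖p.2 i‖ ≤ lam} := by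
      ext p; simp [hC]
    rw [e]
    refine IsClosed.inter (isClosed_le continuous_const continuous_fst) ?_
    exact isClosed_iInter fun i => isClosed_le (by fun_prop) continuous_const
  have hCconv : Convex ℝ C := by
    intro p hp q hq a b ha hb hab
    refine ⟨?_, fun i => ?_⟩
    · have h1 := hp.1
      have h2 := hq.1
      simp only [Prod.fst_add, Prod.smul_fst, smul_eq_mul]
      calc M = a * M + b * M := by rw [← add_mul, hab, one_mul]
        _ ≤ _ := by gcongr
    · have h1 := hp.2 i
      have h2 := hq.2 i
      simp only [Prod.snd_add, Prod.smul_snd, Pi.add_apply, Pi.smul_apply]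
      refine (norm_add_le _ _).trans ?_
      rw [norm_smul, norm_smul, Real.norm_of_nonneg ha, Real.norm_of_nonneg hb]
      calc _ ≤ a * lam + b * lam := by gcongr
        _ = lam := by rw [← add_mul, hab, one_mul]
  have hdisj : Disjoint (T '' K) C := by
    rw [Set.disjoint_left]
    rintro _ ⟨f, hf, rfl⟩ ⟨h1, h2⟩
    exact absurd (hFM f hf fun i hi => h2 ⟨i, hi⟩) (not_lt.2 h1)
  obtain ⟨f, u, v, hu, huv, hv⟩ := geometric_hahn_banach_compact_closed
    (hKc.is_linear_image T.toLinearMap.isLinear) (hK.image T.continuous) hCconv hCclosed hdisj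
  set s := f (1, 0) with hs
  let δ' : F → V := fun i => (InnerProductSpace.toDual ℝ V).symm
    ((f.comp (ContinuousLinearMap.inr ℝ ℝ (F → V))).comp (ContinuousLinearMap.single ℝ (fun _ => V) i))
  have hδ' : ∀ i w, ⟪δ' i, w⟫ = f (0, Pi.single i w) := by
    intro i w
    rw [InnerProductSpace.toDual_symm_apply]; rfl
  have hrep : ∀ (t : ℝ) (w : F → V), f (t, w) = t * s + ∑ i, ⟪δ' i, w i⟫ := by
    intro t w
    have e1 : ((t, w) : ℝ × (F → V)) = t • ((1 : ℝ), (0 : F → V)) +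
        ∑ i, ((0 : ℝ), (Pi.single i (w i) : F → V)) := by
      ext1
      · simp [Prod.fst_sum]
      · simp only [Prod.snd_add, Prod.smul_snd, smul_zero, Prod.snd_sum, zero_add]
        exact (Finset.univ_sum_single w).symm
    rw [e1, map_add, map_smul, map_sum]
    simp only [hδ', smul_eq_mul, hs]
  have hu0 : 0 < u := by
    have := hu (T 0) (mem_image_of_mem T h0)
    simpa using this
  have hspos : 0 < s := by
    have := hv (M, 0) ⟨le_rfl, by simp [hlam.le]⟩
    rw [hrep] at this
    simp only [Pi.zero_apply, inner_zero_right, Finset.sum_const_zero, add_zero] at this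
    by_contra hneg
    nlinarith [not_lt.1 hneg]
  have hw : v < M * s - lam * ∑ i, ‖δ' i‖ := by
    have := hv (M, fun i => -((lam / ‖δ' i‖) • δ' i)) ⟨le_rfl, fun i => by
      simp only [norm_neg, norm_smul, norm_div, norm_norm, Real.norm_of_nonneg hlam.le]
      rcases (norm_nonneg (δ' i)).eq_or_lt with h | h
      · rw [← h]; simpa using hlam.le
      · rw [div_mul_cancel₀ _ h.ne']⟩
    rw [hrep] at this
    have e : ∀ i, ⟪δ' i, -((lam / ‖δ' i‖) • δ' i)⟫ = - (lam * ‖δ' i‖) := by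
      intro i
      rw [inner_neg_right, real_inner_smul_right, real_inner_self_eq_norm_sq]
      rcases (norm_nonneg (δ' i)).eq_or_lt with h | h
      · rw [← h]; simp
      · field_simp
    simp only [e, Finset.sum_neg_distrib, ← Finset.mul_sum] at this
    linarith
  refine ⟨F, fun i => if h : i ∈ F then - (s⁻¹ • δ' ⟨i, h⟩) else 0, Finset.mem_insert_self _ _, ?_⟩
  intro g hg
  have h1 := hu (T g) (mem_image_of_mem T hg)
  change f (D g, fun i : F => ev i g) < u at h1
  rw [hrep] at h1
  rw [← Finset.sum_attach F, ← Finset.sum_attach F (fun i => ‖_‖)]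
  simp only [Finset.coe_mem, dite_true, Subtype.coe_eta, norm_neg, norm_smul, norm_inv,
    Real.norm_of_nonneg hspos.le, inner_neg_right, real_inner_smul_right, Finset.sum_neg_distrib,
    ← Finset.mul_sum]
  simp only [Finset.univ_eq_attach] at h1 hw
  have e2 : ∑ i ∈ F.attach, ⟪ev (i : ι) g, δ' i⟫ = ∑ i ∈ F.attach, ⟪δ' i, ev (i : ι) g⟫ :=
    Finset.sum_congr rfl fun i _ => real_inner_comm _ _
  rw [e2]
  set P := ∑ i ∈ F.attach, ⟪δ' i, ev (i : ι) g⟫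
  set Q := ∑ i ∈ F.attach, ‖δ' i‖
  have h3 : D g * s + P + lam * Q ≤ M * s := by linarith
  have h4 : D g - -(s⁻¹ * P) + lam * (s⁻¹ * Q) = (D g * s + P + lam * Q) / s := by
    field_simp
    ring
  rw [h4, div_le_iff₀ hspos]
  exact h3

lemma ae_mem_vm {Ω : Set (Euc d)} (μ : VMeas Ω V) : ∀ᵐ x ∂μ.ρ, x ∈ Ω := by
  rw [ae_iff]; exact μ.null_compl

lemma pair_congr {Ω : Set (Euc d)} (μ : VMeas Ω V) {φ φ' : Euc d → V} (h : EqOn φ φ' Ω) :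
    μ.pair φ = μ.pair φ' := by
  refine integral_congr_ae ?_
  filter_upwards [ae_mem_vm μ] with x hx
  rw [h hx]

lemma pair_int {Ω : Set (Euc d)} (hΩ : IsCompact Ω) (μ : VMeas Ω V) {φ : Euc d → V}
    (hφ : ContinuousOn φ Ω) : Integrable (fun x => ⟪φ x, μ.den x⟫) μ.ρ := by
  obtain ⟨C, hC⟩ := hΩ.exists_bound_of_continuousOn hφ
  have h1 : AEStronglyMeasurable φ μ.ρ := by
    have := hφ.aestronglyMeasurable (μ := μ.ρ) hΩ.measurableSet
    rwa [Measure.restrict_eq_self_of_ae_mem (ae_mem_vm μ)] at this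
  refine (μ.integrable.norm.const_mul C).mono' (h1.inner μ.integrable.aestronglyMeasurable) ?_
  filter_upwards [ae_mem_vm μ] with x hx
  refine (norm_inner_le_norm _ _).trans ?_
  gcongr
  exact hC x hx

lemma pair_le {Ω : Set (Euc d)} (μ : VMeas Ω V) {φ : Euc d → V} {C : ℝ}
    (hC : ∀ x ∈ Ω, ‖φ x‖ ≤ C) : |μ.pair φ| ≤ C * μ.tv := by
  rw [VMeas.pair, VMeas.tv, ← integral_const_mul, ← Real.norm_eq_abs]
  refine norm_integral_le_of_norm_le (μ.integrable.norm.const_mul C) ?_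
  filter_upwards [ae_mem_vm μ] with x hx
  refine (norm_inner_le_norm _ _).trans ?_
  gcongr
  exact hC x hx

lemma pair_comb {Ω : Set (Euc d)} (hΩ : IsCompact Ω) (μ : VMeas Ω V) {φ φ' : Euc d → V}
    (hφ : ContinuousOn φ Ω) (hφ' : ContinuousOn φ' Ω) (a b : ℝ) :
    μ.pair (fun x => a • φ x + b • φ' x) = a * μ.pair φ + b * μ.pair φ' := by
  simp only [VMeas.pair, inner_add_left, real_inner_smul_left]
  rw [integral_add ((pair_int hΩ μ hφ).const_mul a) ((pair_int hΩ μ hφ').const_mul b),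
    integral_const_mul, integral_const_mul]

def atomic {Ω : Set (Euc d)} (hΩ : IsCompact Ω) (S : Finset Ω) (δ : Ω → V) : VMeas Ω V where
  ρ := ∑ i ∈ S, Measure.dirac (i : Euc d)
  den := Function.extend Subtype.val δ 0
  null_compl := by
    simp only [Measure.coe_finsetSum, Finset.sum_apply]
    refine Finset.sum_eq_zero fun i _ => ?_
    rw [Measure.dirac_apply' _ hΩ.measurableSet.compl]
    simp
  integrable := by
    rw [integrable_finsetSum_measure]
    intro i _
    exact integrable_dirac (by simp)

lemma atomic_pair {Ω : Set (Euc d)} (hΩ : IsCompact Ω) (S : Finset Ω) (δ : Ω → V)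
    (φ : Euc d → V) : (atomic hΩ S δ).pair φ = ∑ i ∈ S, ⟪φ i, δ i⟫ := by
  simp only [VMeas.pair, atomic]
  rw [integral_finsetSum_measure fun i _ => integrable_dirac (by simp)]
  refine Finset.sum_congr rfl fun i _ => ?_
  rw [integral_dirac, Subtype.val_injective.extend_apply]

lemma atomic_tv {Ω : Set (Euc d)} (hΩ : IsCompact Ω) (S : Finset Ω) (δ : Ω → V) :
    (atomic hΩ S δ).tv = ∑ i ∈ S, ‖δ i‖ := by
  simp only [VMeas.tv, atomic]
  rw [integral_finsetSum_measure fun i _ => integrable_dirac (by simp)]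
  refine Finset.sum_congr rfl fun i _ => ?_
  rw [integral_dirac, Subtype.val_injective.extend_apply]

open BoundedContinuousFunction

def ext0 {Ω : Set (Euc d)} (f : Ω →ᵇ V) : Euc d → V := Function.extend Subtype.val f 0

lemma ext0_apply {Ω : Set (Euc d)} (f : Ω →ᵇ V) (x : Ω) : ext0 f x = f x :=
  Subtype.val_injective.extend_apply _ _ _

lemma ext0_mem {Ω : Set (Euc d)} (f : Ω →ᵇ V) {x : Euc d} (hx : x ∈ Ω) : ext0 f x = f ⟨x, hx⟩ :=
  ext0_apply f ⟨x, hx⟩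

lemma ext0_cont {Ω : Set (Euc d)} (f : Ω →ᵇ V) : ContinuousOn (ext0 f) Ω := by
  rw [continuousOn_iff_continuous_domRestrict]
  convert f.continuous using 1
  ext x
  exact ext0_apply f x

lemma exists_ext0 {Ω : Set (Euc d)} (hΩ : IsCompact Ω) {φ : Euc d → V} (hφ : ContinuousOn φ Ω) :
    ∃ f : Ω →ᵇ V, EqOn (ext0 f) φ Ω := by
  have : CompactSpace Ω := isCompact_iff_compactSpace.1 hΩ
  refine ⟨mkOfCompact ⟨Ω.domRestrict φ, hφ.domRestrict⟩, fun x hx => ?_⟩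
  rw [ext0_mem _ hx]; rfl

def AR (Ω : Set (Euc d)) (V : Type*) [NormedAddCommGroup V] [InnerProductSpace ℝ V]
    (R : ℝ) : Set (Ω →ᵇ V) :=
  {f | FrLipOn 1 Ω (ext0 f) ∧ ∀ x, ‖f x‖ ≤ R}

lemma AR_zero {Ω : Set (Euc d)} (hΩ : IsCompact Ω) {c : V} {R : ℝ} (hR : ‖c‖ ≤ R) :
    BoundedContinuousFunction.const Ω c ∈ AR Ω V R := by
  refine ⟨?_, fun x => by simpa using hR⟩
  have h := frlip_const (V := V) hΩ c
  obtain ⟨hc, g, hgm, hg1, hg⟩ := h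
  refine frlip_congr hΩ ?_ ⟨hc, g, hgm, hg1.mono fun x hx => hx.trans zero_le_one, hg⟩
  intro x hx
  rw [ext0_mem _ hx]; rfl

lemma AR_convex {Ω : Set (Euc d)} (hΩ : IsCompact Ω) (R : ℝ) : Convex ℝ (AR Ω V R) := by
  intro f hf g hg a b ha hb hab
  refine ⟨?_, fun x => ?_⟩
  · have h := frlip_comb hΩ a b hf.1 hg.1
    rw [abs_of_nonneg ha, abs_of_nonneg hb, mul_one, mul_one, hab] at h
    refine frlip_congr hΩ ?_ h
    intro x hx
    simp only [ext0_mem _ hx]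
    rfl
  · have h1 := hf.2 x
    have h2 := hg.2 x
    refine (norm_add_le _ _).trans ?_
    change ‖a • f x‖ + ‖b • g x‖ ≤ R
    rw [norm_smul, norm_smul, Real.norm_of_nonneg ha, Real.norm_of_nonneg hb]
    calc _ ≤ a * R + b * R := by gcongr
      _ = R := by rw [← add_mul, hab, one_mul]

lemma AR_closed {Ω : Set (Euc d)} (hΩ : IsCompact Ω) (R : ℝ) : IsClosed (AR Ω V R) := by
  apply IsSeqClosed.isClosed
  intro fn f hfn hlim
  refine ⟨?_, fun x => ?_⟩
  · refine frlip_closed hΩ (fun n => (hfn n).1) (ext0_cont f) ?_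
    intro ε hε
    filter_upwards [Metric.tendsto_nhds.1 hlim ε hε] with n hn x hx
    rw [ext0_mem _ hx, ext0_mem _ hx, ← dist_eq_norm]
    exact (BoundedContinuousFunction.dist_coe_le_dist _).trans hn.le
  · have h1 : Tendsto (fun n => ‖fn n x‖) atTop (𝓝 ‖f x‖) :=
      (((BoundedContinuousFunction.evalCLM ℝ x : (Ω →ᵇ V) →L[ℝ] V).continuous.tendsto f).comp hlim).norm
    exact le_of_tendsto h1 (Eventually.of_forall fun n => (hfn n).2 x)

lemma AR_compact {Ω : Set (Euc d)} (hΩ : IsCompact Ω) (hconv : Convex ℝ Ω)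
    (hint : (interior Ω).Nonempty) (R : ℝ) : IsCompact (AR Ω V R) := by
  have : CompactSpace Ω := isCompact_iff_compactSpace.1 hΩ
  have : ProperSpace V := FiniteDimensional.proper_real V
  refine arzela_ascoli₂ (Metric.closedBall (0 : V) R) (isCompact_closedBall _ _) _
    (AR_closed hΩ R) (fun f x hf => by simpa using hf.2 x) ?_
  refine (LipschitzWith.uniformEquicontinuous (K := 1) _ fun f => ?_).equicontinuous
  have h := frlip_lip Ω hΩ hconv hint _ f.2.1
  refine LipschitzWith.of_dist_le_mul fun x y => ?_
  have := h.dist_le_mul x x.2 y y.2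
  rwa [ext0_apply, ext0_apply] at this

def Dlin {Ω : Set (Euc d)} (hΩ : IsCompact Ω) (μ ν : VMeas Ω V) : (Ω →ᵇ V) →L[ℝ] ℝ :=
  LinearMap.mkContinuous
    { toFun := fun f => ν.pair (ext0 f) - μ.pair (ext0 f)
      map_add' := by
        intro f g
        have h : EqOn (ext0 (f + g)) (fun x => (1:ℝ) • ext0 f x + (1:ℝ) • ext0 g x) Ω := by
          intro x hx
          simp [ext0_mem _ hx]
        rw [pair_congr ν h, pair_congr μ h, pair_comb hΩ ν (ext0_cont f) (ext0_cont g),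
          pair_comb hΩ μ (ext0_cont f) (ext0_cont g)]
        ring
      map_smul' := by
        intro a f
        have h : EqOn (ext0 (a • f)) (fun x => a • ext0 f x + (0:ℝ) • ext0 f x) Ω := by
          intro x hx
          simp [ext0_mem _ hx]
        rw [pair_congr ν h, pair_congr μ h, pair_comb hΩ ν (ext0_cont f) (ext0_cont f),
          pair_comb hΩ μ (ext0_cont f) (ext0_cont f)]
        simp
        ring } (ν.tv + μ.tv) (by
      intro f
      have hb : ∀ x ∈ Ω, ‖ext0 f x‖ ≤ ‖f‖ := fun x hx => by
        rw [ext0_mem _ hx]; exact f.norm_coe_le_norm _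
      have h1 := pair_le ν hb
      have h2 := pair_le μ hb
      change |ν.pair (ext0 f) - μ.pair (ext0 f)| ≤ _
      have := abs_sub (ν.pair (ext0 f)) (μ.pair (ext0 f))
      linarith)

lemma Dlin_apply {Ω : Set (Euc d)} (hΩ : IsCompact Ω) (μ ν : VMeas Ω V) (f : Ω →ᵇ V) :
    Dlin hΩ μ ν f = ν.pair (ext0 f) - μ.pair (ext0 f) := rfl

/-- the vector Kantorovich–Rubinstein problem
`sup { ∫_Ω ⟨φ, ν-μ⟩_V : |∇φ|_{V^d,∞} ≤ 1, |φ|_{V,∞} ≤ λ }` admits a maximizer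
`φ₀ ∈ Fr-Lip(Ω,V)`, and its value equals
`T^λ_{1,1}(μ,ν) = inf { W₁^V(μ+δ,ν) + λ ∫_Ω |δ|_V : δ ∈ M(Ω;V) }`. -/
theorem KR_attained_and_eq_T11
    (Ω : Set (Euc d)) (hΩcomp : IsCompact Ω) (hΩconv : Convex ℝ Ω)
    (hΩint : (interior Ω).Nonempty)
    (lam : ℝ) (hlam : 0 < lam) (μ ν : VMeas Ω V) :
    ∃ φ₀ : Euc d → V,
      (FrLipOn 1 Ω φ₀ ∧ ∀ x ∈ Ω, ‖φ₀ x‖ ≤ lam) ∧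
      (∀ φ : Euc d → V, FrLipOn 1 Ω φ → (∀ x ∈ Ω, ‖φ x‖ ≤ lam) →
        ν.pair φ - μ.pair φ ≤ ν.pair φ₀ - μ.pair φ₀) ∧
      ENNReal.ofReal (ν.pair φ₀ - μ.pair φ₀) =
        ⨅ δ : VMeas Ω V,
          (W1fn Ω (fun φ => ν.pair φ - μ.pair φ - δ.pair φ) +
            ENNReal.ofReal (lam * δ.tv)) := by
  classical
  obtain ⟨z0, hz0⟩ := hΩint
  have hx0 : z0 ∈ Ω := interior_subset hz0
  let x0 : Ω := ⟨z0, hx0⟩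
  have hΩint' : (interior Ω).Nonempty := ⟨z0, hz0⟩
  set D := Dlin hΩcomp μ ν with hD
  have hA0 : ∀ R : ℝ, 0 ≤ R → (0 : BoundedContinuousFunction Ω V) ∈ AR Ω V R := by
    intro R hR
    exact AR_zero (c := (0 : V)) hΩcomp (by simpa using hR)
  obtain ⟨f0, hf0, hmax⟩ := (AR_compact (V := V) hΩcomp hΩconv hΩint' lam).exists_isMaxOn
    ⟨0, hA0 lam hlam.le⟩ D.continuous.continuousOn
  have hmax' : ∀ f ∈ AR Ω V lam, D f ≤ D f0 := fun f hf => hmax hf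
  have hm0 : 0 ≤ D f0 := by simpa using hmax' 0 (hA0 lam hlam.le)
  have hbd : ∀ x ∈ Ω, ‖ext0 f0 x‖ ≤ lam := fun x hx => by
    rw [ext0_mem _ hx]; exact hf0.2 _
  refine ⟨ext0 f0, ⟨hf0.1, hbd⟩, ?_, ?_⟩
  · intro φ hφ hφb
    obtain ⟨f, hf⟩ := exists_ext0 hΩcomp hφ.1
    have hfA : f ∈ AR Ω V lam := by
      refine ⟨frlip_congr hΩcomp hf.symm hφ, fun x => ?_⟩
      rw [← ext0_apply, hf x.2]
      exact hφb x x.2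
    rw [← pair_congr ν hf, ← pair_congr μ hf]
    exact hmax' f hfA
  apply le_antisymm
  · refine le_iInf fun δ => ?_
    have h1 : ENNReal.ofReal (ν.pair (ext0 f0) - μ.pair (ext0 f0) - δ.pair (ext0 f0)) ≤
        W1fn Ω (fun φ => ν.pair φ - μ.pair φ - δ.pair φ) :=
      le_iSup₂_of_le (ext0 f0) hf0.1 le_rfl
    have h2 : δ.pair (ext0 f0) ≤ lam * δ.tv := (le_abs_self _).trans (pair_le δ hbd)
    calc ENNReal.ofReal (ν.pair (ext0 f0) - μ.pair (ext0 f0))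
        ≤ ENNReal.ofReal ((ν.pair (ext0 f0) - μ.pair (ext0 f0) - δ.pair (ext0 f0))
          + lam * δ.tv) := ENNReal.ofReal_le_ofReal (by linarith)
      _ ≤ _ := ENNReal.ofReal_add_le
      _ ≤ _ := by gcongr
  · change _ ≤ ENNReal.ofReal (D f0)
    have main : ∀ ε : ℝ, 0 < ε → ∃ δ : VMeas Ω V,
        W1fn Ω (fun φ => ν.pair φ - μ.pair φ - δ.pair φ) + ENNReal.ofReal (lam * δ.tv)
          ≤ ENNReal.ofReal (D f0 + 2 * ε) := by
      intro ε hε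
      obtain ⟨C0, hC0⟩ := hΩcomp.isBounded.exists_norm_le
      have hC0p : 0 ≤ C0 := (norm_nonneg _).trans (hC0 z0 hx0)
      set M := D f0 + ε with hM
      have hMpos : 0 < M := by linarith
      set R := 2 * C0 + lam * M / ε + 1 with hR
      have hq : 0 ≤ lam * M / ε := by positivity
      have hRpos : 0 < R := by linarith
      let ev : Ω → (BoundedContinuousFunction Ω V) →L[ℝ] V :=
        fun x => BoundedContinuousFunction.evalCLM ℝ x
      have hev : ∀ x f, ev x f = f x := fun _ _ => rfl
      obtain ⟨F, δ, hxF, hF⟩ := dual_abs (AR Ω V R) (AR_compact hΩcomp hΩconv hΩint' R)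
        (AR_convex hΩcomp R) (hA0 R hRpos.le) D ev lam M hlam x0 (by
          intro f hf hfb
          have := hmax' f ⟨hf.1, hfb⟩
          linarith)
      simp only [hev] at hF
      set Q := ∑ i ∈ F, ‖δ i‖ with hQ
      have hQ0 : 0 ≤ Q := Finset.sum_nonneg fun i _ => norm_nonneg _
      have hMQ : 0 ≤ M - lam * Q := by
        have := hF 0 (hA0 R hRpos.le)
        simp at this
        linarith
      -- the mass defect
      have hpairc : ∀ (ρ : VMeas Ω V) (v : V), ρ.pair (fun _ => v) = ⟪v, ρ.mass⟫ := by
        intro ρ v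
        exact integral_inner ρ.integrable v
      have hDc : ∀ v : V, D (BoundedContinuousFunction.const Ω v) = ⟪v, ν.mass - μ.mass⟫ := by
        intro v
        have h : EqOn (ext0 (BoundedContinuousFunction.const Ω v)) (fun _ => v) Ω := by
          intro x hx
          rw [ext0_mem _ hx]; rfl
        rw [hD, Dlin_apply, pair_congr ν h, pair_congr μ h, hpairc, hpairc, inner_sub_right]
      set c : V := ν.mass - μ.mass - ∑ i ∈ F, δ i with hc
      have hcn : lam * ‖c‖ ≤ ε := by
        rcases (norm_nonneg c).eq_or_lt with h0 | h0
        · rw [← h0]; simpa using hε.le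
        have hn : ‖(R / ‖c‖) • c‖ ≤ R := by
          rw [norm_smul, Real.norm_of_nonneg (by positivity), div_mul_cancel₀ _ h0.ne']
        have h1 := hF _ (AR_zero (V := V) hΩcomp hn)
        rw [hDc] at h1
        simp only [BoundedContinuousFunction.const_apply] at h1
        rw [← inner_sum, ← inner_sub_right, ← hc, real_inner_smul_left,
          real_inner_self_eq_norm_sq] at h1
        have h2 : R / ‖c‖ * ‖c‖ ^ 2 = R * ‖c‖ := by field_simp
        rw [h2] at h1
        have h3 : R * ‖c‖ ≤ M := by nlinarith
        have h4 : lam * M / ε * ‖c‖ ≤ M := by nlinarith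
        rw [div_mul_eq_mul_div, div_le_iff₀ hε] at h4
        have h5 : M * (lam * ‖c‖) ≤ M * ε := by linarith
        exact le_of_mul_le_mul_left h5 hMpos
      let δ2 : Ω → V := fun i => δ i + if i = x0 then c else 0
      have hpair2 : ∀ φ : Euc d → V, (atomic hΩcomp F δ2).pair φ
          = ∑ i ∈ F, ⟪φ i, δ i⟫ + ⟪φ z0, c⟫ := by
        intro φ
        rw [atomic_pair]
        simp only [δ2, inner_add_right, Finset.sum_add_distrib]
        congr 1
        rw [Finset.sum_eq_single x0]
        · simp [x0]
        · intro b _ hb; simp [hb]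
        · intro h; exact absurd hxF h
      have htv2 : (atomic hΩcomp F δ2).tv ≤ Q + ‖c‖ := by
        rw [atomic_tv]
        calc ∑ i ∈ F, ‖δ2 i‖ ≤ ∑ i ∈ F, (‖δ i‖ + ‖if i = x0 then c else 0‖) :=
              Finset.sum_le_sum fun i _ => norm_add_le _ _
          _ = Q + ‖c‖ := by
              rw [Finset.sum_add_distrib, Finset.sum_eq_single x0 (f := fun i => ‖if i = x0 then c else 0‖)]
              · simp [hQ]
              · intro b _ hb; simp [hb]
              · intro h; exact absurd hxF h
      refine ⟨atomic hΩcomp F δ2, ?_⟩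
      have hW : W1fn Ω (fun φ => ν.pair φ - μ.pair φ - (atomic hΩcomp F δ2).pair φ)
          ≤ ENNReal.ofReal (M - lam * Q) := by
        refine iSup₂_le fun φ hφ => ENNReal.ofReal_le_ofReal ?_
        have hφ : FrLipOn 1 Ω φ := hφ
        set φ' : Euc d → V := fun x => (1 : ℝ) • φ x + (-1 : ℝ) • φ z0 with hφ'
        have hφ'1 : FrLipOn 1 Ω φ' := by
          have := frlip_comb hΩcomp 1 (-1) hφ (frlip_const hΩcomp (φ z0))
          simpa [hφ'] using this
        obtain ⟨f, hf⟩ := exists_ext0 hΩcomp hφ'1.1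
        have hlip := frlip_lip Ω hΩcomp hΩconv hΩint' φ hφ
        have hfx : ∀ x : Ω, f x = φ x - φ z0 := by
          intro x
          rw [← ext0_apply, hf x.2]
          simp [hφ', sub_eq_add_neg]
        have hfA : f ∈ AR Ω V R := by
          refine ⟨frlip_congr hΩcomp hf.symm hφ'1, fun x => ?_⟩
          rw [hfx, ← dist_eq_norm]
          have h1 := hlip.dist_le_mul x x.2 z0 hx0
          rw [NNReal.coe_one, one_mul, dist_eq_norm (x : Euc d)] at h1
          have h2 := norm_sub_le (x : Euc d) z0
          have h3 := hC0 x x.2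
          have h4 := hC0 z0 hx0
          linarith
        have h1 := hF f hfA
        have h2 : D f = ν.pair φ - μ.pair φ - ⟪φ z0, ν.mass - μ.mass⟫ := by
          rw [hD, Dlin_apply, pair_congr ν hf, pair_congr μ hf, hφ',
            pair_comb hΩcomp ν hφ.1 continuousOn_const, pair_comb hΩcomp μ hφ.1 continuousOn_const,
            hpairc, hpairc, inner_sub_right]
          ring
        rw [h2] at h1
        simp only [hfx, inner_sub_left, Finset.sum_sub_distrib] at h1
        rw [← inner_sum] at h1
        beta_reduce
        rw [hpair2, hc, inner_sub_right]
        linarith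
      calc _ ≤ ENNReal.ofReal (M - lam * Q) + ENNReal.ofReal (lam * (Q + ‖c‖)) := by gcongr
        _ = ENNReal.ofReal (M - lam * Q + lam * (Q + ‖c‖)) :=
            (ENNReal.ofReal_add hMQ (by positivity)).symm
        _ ≤ ENNReal.ofReal (D f0 + 2 * ε) := ENNReal.ofReal_le_ofReal (by linarith)
    refine ENNReal.le_of_forall_pos_le_add fun ε hε _ => ?_
    obtain ⟨δ, hδ⟩ := main (ε / 2) (by positivity)
    refine (iInf_le _ δ).trans (hδ.trans ?_)
    rw [mul_div_cancel₀ _ two_ne_zero, ENNReal.ofReal_add hm0 ε.coe_nonneg]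
    simp
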